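/- Define 𝔣(s₁,s₂,w) = 14(w²+1)s₁⁴ + 4(−5w³+2w)s₁³s₂ + (8w⁴−39w²+1)s₁²s₂² + 8(2w³−3w)s₁s₂³ + 4(w²−1)s₂⁴ + 4(9w³+2w)s₁³ + (−39w⁴+76w²−41)s₁²s₂ + 2(2w⁵−49w³+57w)s₁s₂² + 4(w⁶+6w⁴−14w²+9)s₂³ + (−17w⁴+39w²+164)s₁² + (w⁵−32w³−62w)s₁s₂ + 3(3w⁴+19w²−16)s₂² + 2(−7w⁵+57w³−10w)s₁ + (−3w⁶−8w⁴+207w²−216)s₂ + (w⁶+21w⁴+32w²+432), and 𝔤(s₁,s₂,w) = −4s₁⁴ + 4w s₁³s₂ + s₁²s₂² − 4w s₁³ + 18s₁²s₂ − 18w s₁s₂² − 4s₂³ − 27s₁² + 72w s₁s₂ − 27w²s₂² − 54w s₁ + 54w²s₂ − 27w². Then for every ς ∈ [0,√6) and all real numbers s₁, w: if 𝔤(s₁, −ς−w s₁, w) ≥ 0 then 𝔣(s₁, −ς−w s₁, w) > 0. -/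

import Mathlib

noncomputable def frakf (s1 s2 w : ℝ) : ℝ :=
  14*(w^2 + 1)*s1^4 + 4*(-5*w^3 + 2*w)*s1^3*s2 + (8*w^4 - 39*w^2 + 1)*s1^2*s2^2
  + 8*(2*w^3 - 3*w)*s1*s2^3 + 4*(w^2 - 1)*s2^4 + 4*(9*w^3 + 2*w)*s1^3
  + (-39*w^4 + 76*w^2 - 41)*s1^2*s2 + 2*(2*w^5 - 49*w^3 + 57*w)*s1*s2^2
  + 4*(w^6 + 6*w^4 - 14*w^2 + 9)*s2^3 + (-17*w^4 + 39*w^2 + 164)*s1^2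
  + (w^5 - 32*w^3 - 62*w)*s1*s2 + 3*(3*w^4 + 19*w^2 - 16)*s2^2
  + 2*(-7*w^5 + 57*w^3 - 10*w)*s1 + (-3*w^6 - 8*w^4 + 207*w^2 - 216)*s2
  + (w^6 + 21*w^4 + 32*w^2 + 432)

noncomputable def frakg (s1 s2 w : ℝ) : ℝ :=
  -4*s1^4 + 4*w*s1^3*s2 + s1^2*s2^2 - 4*w*s1^3 + 18*s1^2*s2 - 18*w*s1*s2^2
  - 4*s2^3 - 27*s1^2 + 72*w*s1*s2 - 27*w^2*s2^2 - 54*w*s1 + 54*w^2*s2 - 27*w^2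


/-! ### Tensors of coefficients of homogeneous polynomials -/

/-- `HP M n`: binary forms of degree `n` with coefficients in `M`. -/
def HP (M : Type) : ℕ → Type
  | 0 => M
  | n + 1 => M × HP M n

namespace HP

variable {M : Type}

def ofList (z : M) : (n : ℕ) → List M → HP M n
  | 0, l => l.headD z
  | n + 1, l => (l.headD z, ofList z n l.tail)

/-- evaluation: the `i`-th coefficient multiplies `a^i b^(n-i)`. -/
noncomputable def ev (e : M → ℝ) (a b : ℝ) : (n : ℕ) → HP M n → ℝ
  | 0, x => e x
  | n + 1, x => e x.1 * b ^ (n + 1) + a * ev e a b n x.2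

def add (ad : M → M → M) : (n : ℕ) → HP M n → HP M n → HP M n
  | 0, x, y => ad x y
  | n + 1, x, y => (ad x.1 y.1, add ad n x.2 y.2)

def step (ad : M → M → M) : (n : ℕ) → M → HP M n → HP M (n + 1)
  | 0, c, h => (ad c h, h)
  | n + 1, c, x => (ad c x.1, step ad n x.1 x.2)

/-- the substitution `a ↦ a + b`. -/
def shift (ad : M → M → M) : (n : ℕ) → HP M n → HP M n
  | 0, x => x
  | n + 1, x => step ad n x.1 (shift ad n x.2)

def snoc : (n : ℕ) → HP M n → M → HP M (n + 1)
  | 0, x, c => (x, c)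
  | n + 1, x, c => (x.1, snoc n x.2 c)

def rev : (n : ℕ) → HP M n → HP M n
  | 0, x => x
  | n + 1, x => snoc n (rev n x.2) x.1

/-- the substitution `b ↦ a + b`. -/
def shiftB (ad : M → M → M) (n : ℕ) (x : HP M n) : HP M n := rev n (shift ad n (rev n x))

def map (φ : M → M) : (n : ℕ) → HP M n → HP M n
  | 0, x => φ x
  | n + 1, x => (φ x.1, map φ n x.2)

def all (p : M → Bool) : (n : ℕ) → HP M n → Bool
  | 0, x => p x
  | n + 1, x => p x.1 && all p n x.2

theorem ev_add (ad : M → M → M) (e : M → ℝ) (h : ∀ x y, e (ad x y) = e x + e y) (a b : ℝ) :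
    ∀ (n : ℕ) (x y : HP M n), ev e a b n (add ad n x y) = ev e a b n x + ev e a b n y
  | 0, x, y => h x y
  | n + 1, x, y => by
      simp only [ev, add, h, ev_add ad e h a b n]; ring

theorem ev_step (ad : M → M → M) (e : M → ℝ) (h : ∀ x y, e (ad x y) = e x + e y) (a b : ℝ) :
    ∀ (n : ℕ) (c : M) (x : HP M n),
      ev e a b (n + 1) (step ad n c x) = e c * b ^ (n + 1) + (a + b) * ev e a b n x
  | 0, c, x => by
      have h1 : e (ad c x) = e c + e x := h c x
      change e (ad c x) * b ^ 1 + a * e x = e c * b ^ 1 + (a + b) * e x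
      rw [h1]; ring
  | n + 1, c, x => by
      change e (ad c x.1) * b ^ (n + 2) + a * ev e a b (n + 1) (step ad n x.1 x.2)
        = e c * b ^ (n + 2) + (a + b) * (e x.1 * b ^ (n + 1) + a * ev e a b n x.2)
      rw [h, ev_step ad e h a b n]; ring

theorem ev_shift (ad : M → M → M) (e : M → ℝ) (h : ∀ x y, e (ad x y) = e x + e y) (a b : ℝ) :
    ∀ (n : ℕ) (x : HP M n), ev e a b n (shift ad n x) = ev e (a + b) b n x
  | 0, x => rfl
  | n + 1, x => by
      change ev e a b (n + 1) (step ad n x.1 (shift ad n x.2))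
        = e x.1 * b ^ (n + 1) + (a + b) * ev e (a + b) b n x.2
      rw [ev_step ad e h, ev_shift ad e h a b n]

theorem ev_snoc (e : M → ℝ) (a b : ℝ) :
    ∀ (n : ℕ) (x : HP M n) (c : M),
      ev e a b (n + 1) (snoc n x c) = b * ev e a b n x + e c * a ^ (n + 1)
  | 0, x, c => by simp only [ev, snoc]; ring
  | n + 1, x, c => by
      change e x.1 * b ^ (n + 2) + a * ev e a b (n + 1) (snoc n x.2 c)
        = b * (e x.1 * b ^ (n + 1) + a * ev e a b n x.2) + e c * a ^ (n + 2)
      rw [ev_snoc e a b n]; ring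

theorem ev_rev (e : M → ℝ) (a b : ℝ) :
    ∀ (n : ℕ) (x : HP M n), ev e a b n (rev n x) = ev e b a n x
  | 0, x => rfl
  | n + 1, x => by
      change ev e a b (n + 1) (snoc n (rev n x.2) x.1) = e x.1 * a ^ (n + 1) + b * ev e b a n x.2
      rw [ev_snoc, ev_rev e a b n]; ring

theorem ev_shiftB (ad : M → M → M) (e : M → ℝ) (h : ∀ x y, e (ad x y) = e x + e y) (a b : ℝ)
    (n : ℕ) (x : HP M n) : ev e a b n (shiftB ad n x) = ev e a (a + b) n x := by
  rw [shiftB, ev_rev, ev_shift ad e h, ev_rev, add_comm b a]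

theorem ev_map (φ : M → M) (e e' : M → ℝ) (h : ∀ x, e (φ x) = e' x) (a b : ℝ) :
    ∀ (n : ℕ) (x : HP M n), ev e a b n (map φ n x) = ev e' a b n x
  | 0, x => h x
  | n + 1, x => by simp only [map, ev, h, ev_map φ e e' h a b n]

theorem ev_nonneg (p : M → Bool) (e : M → ℝ) (h : ∀ x, p x = true → 0 ≤ e x) (a b : ℝ)
    (ha : 0 ≤ a) (hb : 0 ≤ b) :
    ∀ (n : ℕ) (x : HP M n), all p n x = true → 0 ≤ ev e a b n x
  | 0, x, hx => h x hx
  | n + 1, x, hx => by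
      simp only [all, Bool.and_eq_true] at hx
      have h1 := h _ hx.1
      have h2 := ev_nonneg p e h a b ha hb n _ hx.2
      simp only [ev]
      positivity

end HP

/-! ### Three pairs of variables -/

/-- Coefficient tensors of trihomogeneous polynomials. -/
abbrev Ten (k m n : ℕ) : Type := HP (HP (HP ℤ n) m) k

namespace Ten

variable {k m n : ℕ}

def ofLists (k m n : ℕ) (l : List (List (List ℤ))) : Ten k m n :=
  HP.ofList (HP.ofList (HP.ofList 0 n []) m []) k
    (l.map fun r => HP.ofList (HP.ofList 0 n []) m (r.map fun q => HP.ofList 0 n q))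

noncomputable def ev2 (e g : ℝ) (x : HP ℤ n) : ℝ := HP.ev (fun z : ℤ => (z : ℝ)) e g n x
noncomputable def ev1 (c d e g : ℝ) (x : HP (HP ℤ n) m) : ℝ := HP.ev (ev2 e g) c d m x
noncomputable def ev (a b c d e g : ℝ) (x : Ten k m n) : ℝ := HP.ev (ev1 c d e g) a b k x

def ad2 (x y : HP ℤ n) : HP ℤ n := HP.add (fun u v => u + v) n x y
def ad1 (x y : HP (HP ℤ n) m) : HP (HP ℤ n) m := HP.add ad2 m x y

theorem ev2_add (e g : ℝ) (x y : HP ℤ n) : ev2 e g (ad2 x y) = ev2 e g x + ev2 e g y :=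
  HP.ev_add _ _ (fun u v => by push_cast; rfl) e g n x y

theorem ev1_add (c d e g : ℝ) (x y : HP (HP ℤ n) m) :
    ev1 c d e g (ad1 x y) = ev1 c d e g x + ev1 c d e g y :=
  HP.ev_add _ _ (ev2_add e g) c d m x y

/-- substitution `a ↦ a + b` in the pair number `v`. -/
def subA (v : ℕ) (x : Ten k m n) : Ten k m n :=
  match v with
  | 0 => HP.shift ad1 k x
  | 1 => HP.map (HP.shift ad2 m) k x
  | _ => HP.map (HP.map (HP.shift (fun u v => u + v) n) m) k x

/-- substitution `b ↦ a + b` in the pair number `v`. -/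
def subB (v : ℕ) (x : Ten k m n) : Ten k m n :=
  match v with
  | 0 => HP.shiftB ad1 k x
  | 1 => HP.map (HP.shiftB ad2 m) k x
  | _ => HP.map (HP.map (HP.shiftB (fun u v => u + v) n) m) k x

theorem ev_subA0 (a b c d e g : ℝ) (x : Ten k m n) :
    ev a b c d e g (subA 0 x) = ev (a + b) b c d e g x :=
  HP.ev_shift _ _ (ev1_add c d e g) a b k x

theorem ev_subB0 (a b c d e g : ℝ) (x : Ten k m n) :
    ev a b c d e g (subB 0 x) = ev a (a + b) c d e g x :=
  HP.ev_shiftB _ _ (ev1_add c d e g) a b k x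

theorem ev_subA1 (a b c d e g : ℝ) (x : Ten k m n) :
    ev a b c d e g (subA 1 x) = ev a b (c + d) d e g x :=
  HP.ev_map _ _ _ (fun y => HP.ev_shift _ _ (ev2_add e g) c d m y) a b k x

theorem ev_subB1 (a b c d e g : ℝ) (x : Ten k m n) :
    ev a b c d e g (subB 1 x) = ev a b c (c + d) e g x :=
  HP.ev_map _ _ _ (fun y => HP.ev_shiftB _ _ (ev2_add e g) c d m y) a b k x

theorem ev_subA2 (v : ℕ) (a b c d e g : ℝ) (x : Ten k m n) :
    ev a b c d e g (subA (v + 2) x) = ev a b c d (e + g) g x :=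
  HP.ev_map _ _ _ (fun y => HP.ev_map _ _ _
    (fun z => HP.ev_shift _ _ (fun u v => by push_cast; rfl) e g n z) c d m y) a b k x

theorem ev_subB2 (v : ℕ) (a b c d e g : ℝ) (x : Ten k m n) :
    ev a b c d e g (subB (v + 2) x) = ev a b c d e (e + g) x :=
  HP.ev_map _ _ _ (fun y => HP.ev_map _ _ _
    (fun z => HP.ev_shiftB _ _ (fun u v => by push_cast; rfl) e g n z) c d m y) a b k x

/-- all coefficients are nonnegative. -/
def nonneg (x : Ten k m n) : Bool :=
  HP.all (HP.all (HP.all (fun z : ℤ => decide (0 ≤ z)) n) m) k x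

theorem ev_nonneg (x : Ten k m n) (hx : nonneg x = true) (a b c d e g : ℝ) (ha : 0 ≤ a)
    (hb : 0 ≤ b) (hc : 0 ≤ c) (hd : 0 ≤ d) (he : 0 ≤ e) (hg : 0 ≤ g) :
    0 ≤ ev a b c d e g x :=
  HP.ev_nonneg _ _ (fun y hy => HP.ev_nonneg _ _ (fun z hz => HP.ev_nonneg _ _
    (fun t ht => by simpa using ht) e g he hg n z hz) c d hc hd m y hy) a b ha hb k x hx

/-- Subdivision trees: `node v l r` compares the two variables of pair `v`. -/
inductive Tree : Type
  | leaf : Tree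
  | node : ℕ → Tree → Tree → Tree

def check : Tree → Ten k m n → Bool
  | .leaf, x => nonneg x
  | .node v l r, x => check l (subB v x) && check r (subA v x)

theorem ev_nonneg_of_check : ∀ (t : Tree) (x : Ten k m n), check t x = true →
    ∀ a b c d e g : ℝ, 0 ≤ a → 0 ≤ b → 0 ≤ c → 0 ≤ d → 0 ≤ e → 0 ≤ g → 0 ≤ ev a b c d e g x
  | .leaf, x, hx => fun a b c d e g ha hb hc hd he hg =>
      ev_nonneg x hx a b c d e g ha hb hc hd he hg
  | .node v l r, x, hx => by
      intro a b c d e g ha hb hc hd he hg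
      simp only [check, Bool.and_eq_true] at hx
      have hl := ev_nonneg_of_check l _ hx.1
      have hr := ev_nonneg_of_check r _ hx.2
      match v with
      | 0 =>
        rcases le_total a b with h | h
        · have := hl a (b - a) c d e g ha (by linarith) hc hd he hg
          rwa [ev_subB0, add_sub_cancel] at this
        · have := hr (a - b) b c d e g (by linarith) hb hc hd he hg
          rwa [ev_subA0, sub_add_cancel] at this
      | 1 =>
        rcases le_total c d with h | h
        · have := hl a b c (d - c) e g ha hb hc (by linarith) he hg
          rwa [ev_subB1, add_sub_cancel] at this
        · have := hr a b (c - d) d e g ha hb (by linarith) hd he hg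
          rwa [ev_subA1, sub_add_cancel] at this
      | v + 2 =>
        rcases le_total e g with h | h
        · have := hl a b c d e (g - e) ha hb hc hd he (by linarith)
          rwa [ev_subB2, add_sub_cancel] at this
        · have := hr a b c d (e - g) g ha hb hc hd (by linarith) hg
          rwa [ev_subA2, sub_add_cancel] at this

/-- positivity on `[0,1] × [0,1] × [0,∞)`. -/
theorem box_inf (t : Tree) (x : Ten k m n) (hx : check t (subB 0 (subB 1 x)) = true)
    (a c e : ℝ) (ha : 0 ≤ a) (ha1 : a ≤ 1) (hc : 0 ≤ c) (hc1 : c ≤ 1) (he : 0 ≤ e) :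
    0 ≤ ev a 1 c 1 e 1 x := by
  have := ev_nonneg_of_check t _ hx a (1 - a) c (1 - c) e 1 ha (by linarith) hc (by linarith)
    he zero_le_one
  rwa [ev_subB0, ev_subB1, add_sub_cancel, add_sub_cancel] at this

/-- positivity on `[0,1] × [0,1] × [0,1]`. -/
theorem box_one (t : Tree) (x : Ten k m n) (hx : check t (subB 0 (subB 1 (subB 2 x))) = true)
    (a c e : ℝ) (ha : 0 ≤ a) (ha1 : a ≤ 1) (hc : 0 ≤ c) (hc1 : c ≤ 1) (he : 0 ≤ e)
    (he1 : e ≤ 1) : 0 ≤ ev a 1 c 1 e 1 x := by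
  have := ev_nonneg_of_check t _ hx a (1 - a) c (1 - c) e (1 - e) ha (by linarith) hc
    (by linarith) he (by linarith)
  rwa [ev_subB0, ev_subB1, ev_subB2 0, add_sub_cancel, add_sub_cancel, add_sub_cancel] at this

end Ten

/-! ### The polynomial `f` in the variables `s = ς`, `u = s₁ + w`, `w` -/

noncomputable def fu (s u w : ℝ) : ℝ := frakf (u - w) (-s - w * (u - w)) w

noncomputable def f00 (s : ℝ) : ℝ := 4 * (3 + s) * (6 + s) * (6 - s ^ 2)

theorem fu_neg (s u w : ℝ) : fu s (-u) (-w) = fu s u w := by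
  unfold fu frakf; ring

def tabP1p : Ten 4 4 12 := Ten.ofLists 4 4 12
  [[[4310000, 0, 0, 0, 1320000, 0, 480000, 0, 90000, 0, 160000, 0, 40000]], [[4752000, 0,
  -2904000, 0, -1936000, 0, -22000, 0, -1056000, 0, -264000], [0, -1452000, 0, -1188000, 0,
  -704000, 0, -286000, 0, -484000, 0, -132000]], [[-2323200, 0, 2516800, 0, -2516800, 0, 2516800,
  0, 580800], [0, -2807200, 0, 968000, 0, -266200, 0, 1936000, 0, 580800], [1984400, 0, -121000,
  0, 0, 0, 278300, 0, 435600, 0, 145200]], [[-3833280, 0, 5111040, 0, -2555520, 0, -425920], [0,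
  212960, 0, 2768480, 0, -1916640, 0, -638880], [1091420, 0, 1650440, 0, 452540, 0, -425920, 0,
  -319440], [0, -93170, 0, 133100, 0, -93170, 0, -53240, 0, -53240]], [[-937024, 0, 937024], [0,
  937024], [58564, 0, 527076, 0, -937024], [0, -175692, 0, -58564, 0, -468512], [204974, 0,
  102487, 0, 14641, 0, -58564]]]

theorem tabP1p_eq (a c e : ℝ) :
    10000 * (fu (11 / 5 * a) ((11 / 10 * a * c)) e - 1)
      = Ten.ev a 1 c 1 e 1 tabP1p := by
  simp only [tabP1p, Ten.ofLists, Ten.ev, Ten.ev1, Ten.ev2, HP.ofList, HP.ev, List.map, List.headD,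
    List.tail, Int.cast_zero, mul_zero, zero_add, add_zero,
    one_pow, mul_one]
  unfold fu frakf
  push_cast
  ring

theorem posP1p (a c e : ℝ) (ha : 0 ≤ a) (ha1 : a ≤ 1) (hc : 0 ≤ c) (hc1 : c ≤ 1) (he : 0 ≤ e) :
    1 ≤ fu (11 / 5 * a) ((11 / 10 * a * c)) e := by
  have h := Ten.box_inf (.node 2 .leaf (.node 0 (.node 2 .leaf .leaf) (.node 2 (.node 1 .leaf .leaf) (.node 2 (.node 1 .leaf .leaf) .leaf))))
    tabP1p (by decide +kernel) a c e ha ha1 hc hc1 he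
  have h2 := tabP1p_eq a c e
  rw [← h2] at h
  linarith

def tabAp : Ten 4 4 10 := Ten.ofLists 4 4 10
  [[[92747595776, 0, -145620992000, 0, 101955200000, 0, -24075000000, 0, -10156250000, 0,
  6103515625], [-46310359040, 0, 59310080000, 0, -104976000000, 0, 57450000000, 0, 8593750000, 0,
  -18310546875], [42441113600, 0, 43509760000, 0, -16016000000, 0, -7625000000, 0, 9375000000, 0,
  18310546875], [0, 0, -5171200000, 0, 2240000000, 0, -26375000000, 0, -3906250000, 0,
  -6103515625], [0, 0, 3584000000, 0, 2800000000, 0, 625000000, 0, -3906250000]], [[47388819456,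
  0, -51093504000, 0, 20366400000, 0, 900000000, 0, -3515625000], [872939520, 0, 20643840000, 0,
  -20328000000, 0, 5100000000, 0, 7031250000], [2231500800, 0, 7802880000, 0, -6408000000, 0,
  -3000000000, 0, -3515625000], [0, 0, -460800000, 0, -240000000, 0, -3000000000]], [[7151026176,
  0, -4847616000, 0, 921600000, 0, 675000000], [837550080, 0, 1198080000, 0, -1296000000, 0,
  -675000000], [14745600, 0, 207360000, 0, -576000000]], [[368050176, 0, -165888000, 0,
  -43200000], [35389440]], [[5308416]]]

theorem tabAp_eq (a c e : ℝ) :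
    104857600 * (fu (11 / 5 + 3 / 10 * a) ((5 / 4 * c * e)) (5 / 4 * e) - f00 (11 / 5 + 3 / 10 * a))
      = e ^ 2 * Ten.ev a 1 c 1 e 1 tabAp := by
  simp only [tabAp, Ten.ofLists, Ten.ev, Ten.ev1, Ten.ev2, HP.ofList, HP.ev, List.map, List.headD,
    List.tail, Int.cast_zero, mul_zero, zero_add, add_zero,
    one_pow, mul_one]
  unfold fu f00 frakf
  push_cast
  ring

theorem posAp (a c e : ℝ) (ha : 0 ≤ a) (ha1 : a ≤ 1) (hc : 0 ≤ c) (hc1 : c ≤ 1) (he : 0 ≤ e) (he1 : e ≤ 1) :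
    f00 (11 / 5 + 3 / 10 * a) ≤ fu (11 / 5 + 3 / 10 * a) ((5 / 4 * c * e)) (5 / 4 * e) := by
  have h := Ten.box_one .leaf
    tabAp (by decide +kernel) a c e ha ha1 hc hc1 he he1
  have h2 := tabAp_eq a c e
  have h3 : 0 ≤ e ^ 2 * Ten.ev a 1 c 1 e 1 tabAp := mul_nonneg (sq_nonneg _) h
  rw [← h2] at h3
  linarith

def tabBp : Ten 4 10 12 := Ten.ofLists 4 10 12
  [[[42441113600, -46310359040, 92747595776], [], [3584000000, -5171200000, 43509760000,
  59310080000, -145620992000], [], [0, 0, 2800000000, 2240000000, -16016000000, -104976000000,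
  101955200000], [], [0, 0, 0, 0, 625000000, -26375000000, -7625000000, 57450000000,
  -24075000000], [], [0, 0, 0, 0, 0, 0, -3906250000, -3906250000, 9375000000, 8593750000,
  -10156250000], [], [0, 0, 0, 0, 0, 0, 0, 0, 0, -6103515625, 18310546875, -18310546875,
  6103515625]], [[2231500800, 872939520, 47388819456], [], [0, -460800000, 7802880000,
  20643840000, -51093504000], [], [0, 0, 0, -240000000, -6408000000, -20328000000, 20366400000],
  [], [0, 0, 0, 0, 0, -3000000000, -3000000000, 5100000000, 900000000], [], [0, 0, 0, 0, 0, 0, 0,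
  0, -3515625000, 7031250000, -3515625000]], [[14745600, 837550080, 7151026176], [], [0, 0,
  207360000, 1198080000, -4847616000], [], [0, 0, 0, 0, -576000000, -1296000000, 921600000], [],
  [0, 0, 0, 0, 0, 0, 0, -675000000, 675000000]], [[0, 35389440, 368050176], [], [0, 0, 0, 0,
  -165888000], [], [0, 0, 0, 0, 0, 0, -43200000]], [[0, 0, 5308416]]]

theorem tabBp_eq (a c e : ℝ) :
    104857600 * (fu (11 / 5 + 3 / 10 * a) ((5 / 4 * c)) (5 / 4 * c * e) - f00 (11 / 5 + 3 / 10 * a))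
      = c ^ 2 * Ten.ev a 1 c 1 e 1 tabBp := by
  simp only [tabBp, Ten.ofLists, Ten.ev, Ten.ev1, Ten.ev2, HP.ofList, HP.ev, List.map, List.headD,
    List.tail, Int.cast_zero, mul_zero, zero_add, add_zero,
    one_pow, mul_one]
  unfold fu f00 frakf
  push_cast
  ring

theorem posBp (a c e : ℝ) (ha : 0 ≤ a) (ha1 : a ≤ 1) (hc : 0 ≤ c) (hc1 : c ≤ 1) (he : 0 ≤ e) (he1 : e ≤ 1) :
    f00 (11 / 5 + 3 / 10 * a) ≤ fu (11 / 5 + 3 / 10 * a) ((5 / 4 * c)) (5 / 4 * c * e) := by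
  have h := Ten.box_one .leaf
    tabBp (by decide +kernel) a c e ha ha1 hc hc1 he he1
  have h2 := tabBp_eq a c e
  have h3 : 0 ≤ c ^ 2 * Ten.ev a 1 c 1 e 1 tabBp := mul_nonneg (sq_nonneg _) h
  rw [← h2] at h3
  linarith

def tabCp : Ten 4 4 12 := Ten.ofLists 4 4 12
  [[[523851735025, -123557778960, 320806800416, 2975276409600, 6009699761920, 12600447590400,
  19232791838720, 17944461312000, 10654094131200, 4164812800000, 1054081024000, 157286400000,
  10485760000], [-1106076897875, -2303647693300, -5809357410000, -16372033976000, -35571691200000,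
  -51406324992000, -48073589760000, -29756780544000, -12347596800000, -3350364160000,
  -540672000000, -39321600000], [2249885511875, 4706219775000, 14712213910000, 32072980800000,
  44759796160000, 41726016000000, 26870348800000, 11913216000000, 3495321600000, 614400000000,
  49152000000], [-982899140625, -4252031812500, -8940605000000, -11659828000000, -10625400000000,
  -7188064000000, -3539200000000, -1172480000000, -230400000000, -20480000000], [77568750000,
  -306750000000, -832700000000, -968000000000, -593600000000, -192000000000, -25600000000]],
  [[351152261400, -307084541760, -1386869272704, -2157069004800, -4309798440960, -5843673907200,
  -4539776040960, -2174091264000, -659777126400, -117964800000, -9437184000], [333000738000,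
  1202914190400, 3502024320000, 7507057152000, 9859046400000, 7968436224000, 4104683520000,
  1353842688000, 265420800000, 23592960000], [-72231105000, -1123024800000, -2785321920000,
  -3616089600000, -3046417920000, -1760256000000, -664780800000, -147456000000, -14745600000],
  [-92520000000, -323616000000, -491520000000, -387072000000, -153600000000, -24576000000]],
  [[97500254400, 116823767040, 172629282816, 471571660800, 575758172160, 354956083200,
  129902837760, 28311552000, 2831155200], [1615752000, -135464198400, -376652160000,
  -452952576000, -308275200000, -126738432000, -30965760000, -3538944000], [-8847360000,
  -37785600000, -51978240000, -29491200000, -5898240000]], [[3974054400, -3733032960,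
  -20404445184, -19552665600, -8334213120, -2123366400, -283115520], [884736000, 707788800]],
  [[132710400, 212336640, 84934656]]]

theorem tabCp_eq (a c e : ℝ) :
    2621440000 * (fu (11 / 5 + 3 / 10 * a) ((5 / 4 * c)) (5 / 4 + e) - f00 (11 / 5 + 3 / 10 * a))
      = Ten.ev a 1 c 1 e 1 tabCp := by
  simp only [tabCp, Ten.ofLists, Ten.ev, Ten.ev1, Ten.ev2, HP.ofList, HP.ev, List.map, List.headD,
    List.tail, Int.cast_zero, mul_zero, zero_add, add_zero,
    one_pow, mul_one]
  unfold fu f00 frakf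
  push_cast
  ring

theorem posCp (a c e : ℝ) (ha : 0 ≤ a) (ha1 : a ≤ 1) (hc : 0 ≤ c) (hc1 : c ≤ 1) (he : 0 ≤ e) :
    f00 (11 / 5 + 3 / 10 * a) ≤ fu (11 / 5 + 3 / 10 * a) ((5 / 4 * c)) (5 / 4 + e) := by
  have h := Ten.box_inf (.node 1 (.node 2 (.node 2 .leaf .leaf) .leaf) (.node 2 (.node 1 (.node 2 .leaf .leaf) (.node 2 .leaf (.node 1 .leaf .leaf))) (.node 2 (.node 1 .leaf .leaf) .leaf)))
    tabCp (by decide +kernel) a c e ha ha1 hc hc1 he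
  have h2 := tabCp_eq a c e
  rw [← h2] at h
  linarith

def tabP1m : Ten 4 4 12 := Ten.ofLists 4 4 12
  [[[4310000, 0, 0, 0, 1320000, 0, 480000, 0, 90000, 0, 160000, 0, 40000]], [[4752000, 0,
  -2904000, 0, -1936000, 0, -22000, 0, -1056000, 0, -264000], [0, 1452000, 0, 1188000, 0, 704000,
  0, 286000, 0, 484000, 0, 132000]], [[-2323200, 0, 2516800, 0, -2516800, 0, 2516800, 0, 580800],
  [0, 2807200, 0, -968000, 0, 266200, 0, -1936000, 0, -580800], [1984400, 0, -121000, 0, 0, 0,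
  278300, 0, 435600, 0, 145200]], [[-3833280, 0, 5111040, 0, -2555520, 0, -425920], [0, -212960,
  0, -2768480, 0, 1916640, 0, 638880], [1091420, 0, 1650440, 0, 452540, 0, -425920, 0, -319440],
  [0, 93170, 0, -133100, 0, 93170, 0, 53240, 0, 53240]], [[-937024, 0, 937024], [0, -937024],
  [58564, 0, 527076, 0, -937024], [0, 175692, 0, 58564, 0, 468512], [204974, 0, 102487, 0, 14641,
  0, -58564]]]

theorem tabP1m_eq (a c e : ℝ) :
    10000 * (fu (11 / 5 * a) (-(11 / 10 * a * c)) e - 1)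
      = Ten.ev a 1 c 1 e 1 tabP1m := by
  simp only [tabP1m, Ten.ofLists, Ten.ev, Ten.ev1, Ten.ev2, HP.ofList, HP.ev, List.map, List.headD,
    List.tail, Int.cast_zero, mul_zero, zero_add, add_zero,
    one_pow, mul_one]
  unfold fu frakf
  push_cast
  ring

theorem posP1m (a c e : ℝ) (ha : 0 ≤ a) (ha1 : a ≤ 1) (hc : 0 ≤ c) (hc1 : c ≤ 1) (he : 0 ≤ e) :
    1 ≤ fu (11 / 5 * a) (-(11 / 10 * a * c)) e := by
  have h := Ten.box_inf (.node 2 .leaf (.node 2 .leaf .leaf))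
    tabP1m (by decide +kernel) a c e ha ha1 hc hc1 he
  have h2 := tabP1m_eq a c e
  rw [← h2] at h
  linarith

def tabAm : Ten 4 4 10 := Ten.ofLists 4 4 10
  [[[92747595776, 0, -145620992000, 0, 101955200000, 0, -24075000000, 0, -10156250000, 0,
  6103515625], [46310359040, 0, -59310080000, 0, 104976000000, 0, -57450000000, 0, -8593750000, 0,
  18310546875], [42441113600, 0, 43509760000, 0, -16016000000, 0, -7625000000, 0, 9375000000, 0,
  18310546875], [0, 0, 5171200000, 0, -2240000000, 0, 26375000000, 0, 3906250000, 0, 6103515625],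
  [0, 0, 3584000000, 0, 2800000000, 0, 625000000, 0, -3906250000]], [[47388819456, 0,
  -51093504000, 0, 20366400000, 0, 900000000, 0, -3515625000], [-872939520, 0, -20643840000, 0,
  20328000000, 0, -5100000000, 0, -7031250000], [2231500800, 0, 7802880000, 0, -6408000000, 0,
  -3000000000, 0, -3515625000], [0, 0, 460800000, 0, 240000000, 0, 3000000000]], [[7151026176, 0,
  -4847616000, 0, 921600000, 0, 675000000], [-837550080, 0, -1198080000, 0, 1296000000, 0,
  675000000], [14745600, 0, 207360000, 0, -576000000]], [[368050176, 0, -165888000, 0, -43200000],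
  [-35389440]], [[5308416]]]

theorem tabAm_eq (a c e : ℝ) :
    104857600 * (fu (11 / 5 + 3 / 10 * a) (-(5 / 4 * c * e)) (5 / 4 * e) - f00 (11 / 5 + 3 / 10 * a))
      = e ^ 2 * Ten.ev a 1 c 1 e 1 tabAm := by
  simp only [tabAm, Ten.ofLists, Ten.ev, Ten.ev1, Ten.ev2, HP.ofList, HP.ev, List.map, List.headD,
    List.tail, Int.cast_zero, mul_zero, zero_add, add_zero,
    one_pow, mul_one]
  unfold fu f00 frakf
  push_cast
  ring

theorem posAm (a c e : ℝ) (ha : 0 ≤ a) (ha1 : a ≤ 1) (hc : 0 ≤ c) (hc1 : c ≤ 1) (he : 0 ≤ e) (he1 : e ≤ 1) :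
    f00 (11 / 5 + 3 / 10 * a) ≤ fu (11 / 5 + 3 / 10 * a) (-(5 / 4 * c * e)) (5 / 4 * e) := by
  have h := Ten.box_one .leaf
    tabAm (by decide +kernel) a c e ha ha1 hc hc1 he he1
  have h2 := tabAm_eq a c e
  have h3 : 0 ≤ e ^ 2 * Ten.ev a 1 c 1 e 1 tabAm := mul_nonneg (sq_nonneg _) h
  rw [← h2] at h3
  linarith

def tabBm : Ten 4 10 12 := Ten.ofLists 4 10 12
  [[[42441113600, 46310359040, 92747595776], [], [3584000000, 5171200000, 43509760000,
  -59310080000, -145620992000], [], [0, 0, 2800000000, -2240000000, -16016000000, 104976000000,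
  101955200000], [], [0, 0, 0, 0, 625000000, 26375000000, -7625000000, -57450000000,
  -24075000000], [], [0, 0, 0, 0, 0, 0, -3906250000, 3906250000, 9375000000, -8593750000,
  -10156250000], [], [0, 0, 0, 0, 0, 0, 0, 0, 0, 6103515625, 18310546875, 18310546875,
  6103515625]], [[2231500800, -872939520, 47388819456], [], [0, 460800000, 7802880000,
  -20643840000, -51093504000], [], [0, 0, 0, 240000000, -6408000000, 20328000000, 20366400000],
  [], [0, 0, 0, 0, 0, 3000000000, -3000000000, -5100000000, 900000000], [], [0, 0, 0, 0, 0, 0, 0,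
  0, -3515625000, -7031250000, -3515625000]], [[14745600, -837550080, 7151026176], [], [0, 0,
  207360000, -1198080000, -4847616000], [], [0, 0, 0, 0, -576000000, 1296000000, 921600000], [],
  [0, 0, 0, 0, 0, 0, 0, 675000000, 675000000]], [[0, -35389440, 368050176], [], [0, 0, 0, 0,
  -165888000], [], [0, 0, 0, 0, 0, 0, -43200000]], [[0, 0, 5308416]]]

theorem tabBm_eq (a c e : ℝ) :
    104857600 * (fu (11 / 5 + 3 / 10 * a) (-(5 / 4 * c)) (5 / 4 * c * e) - f00 (11 / 5 + 3 / 10 * a))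
      = c ^ 2 * Ten.ev a 1 c 1 e 1 tabBm := by
  simp only [tabBm, Ten.ofLists, Ten.ev, Ten.ev1, Ten.ev2, HP.ofList, HP.ev, List.map, List.headD,
    List.tail, Int.cast_zero, mul_zero, zero_add, add_zero,
    one_pow, mul_one]
  unfold fu f00 frakf
  push_cast
  ring

theorem posBm (a c e : ℝ) (ha : 0 ≤ a) (ha1 : a ≤ 1) (hc : 0 ≤ c) (hc1 : c ≤ 1) (he : 0 ≤ e) (he1 : e ≤ 1) :
    f00 (11 / 5 + 3 / 10 * a) ≤ fu (11 / 5 + 3 / 10 * a) (-(5 / 4 * c)) (5 / 4 * c * e) := by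
  have h := Ten.box_one .leaf
    tabBm (by decide +kernel) a c e ha ha1 hc hc1 he he1
  have h2 := tabBm_eq a c e
  have h3 : 0 ≤ c ^ 2 * Ten.ev a 1 c 1 e 1 tabBm := mul_nonneg (sq_nonneg _) h
  rw [← h2] at h3
  linarith

def tabCm : Ten 4 4 12 := Ten.ofLists 4 4 12
  [[[523851735025, -123557778960, 320806800416, 2975276409600, 6009699761920, 12600447590400,
  19232791838720, 17944461312000, 10654094131200, 4164812800000, 1054081024000, 157286400000,
  10485760000], [1106076897875, 2303647693300, 5809357410000, 16372033976000, 35571691200000,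
  51406324992000, 48073589760000, 29756780544000, 12347596800000, 3350364160000, 540672000000,
  39321600000], [2249885511875, 4706219775000, 14712213910000, 32072980800000, 44759796160000,
  41726016000000, 26870348800000, 11913216000000, 3495321600000, 614400000000, 49152000000],
  [982899140625, 4252031812500, 8940605000000, 11659828000000, 10625400000000, 7188064000000,
  3539200000000, 1172480000000, 230400000000, 20480000000], [77568750000, -306750000000,
  -832700000000, -968000000000, -593600000000, -192000000000, -25600000000]], [[351152261400,
  -307084541760, -1386869272704, -2157069004800, -4309798440960, -5843673907200, -4539776040960,
  -2174091264000, -659777126400, -117964800000, -9437184000], [-333000738000, -1202914190400,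
  -3502024320000, -7507057152000, -9859046400000, -7968436224000, -4104683520000, -1353842688000,
  -265420800000, -23592960000], [-72231105000, -1123024800000, -2785321920000, -3616089600000,
  -3046417920000, -1760256000000, -664780800000, -147456000000, -14745600000], [92520000000,
  323616000000, 491520000000, 387072000000, 153600000000, 24576000000]], [[97500254400,
  116823767040, 172629282816, 471571660800, 575758172160, 354956083200, 129902837760, 28311552000,
  2831155200], [-1615752000, 135464198400, 376652160000, 452952576000, 308275200000, 126738432000,
  30965760000, 3538944000], [-8847360000, -37785600000, -51978240000, -29491200000, -5898240000]],
  [[3974054400, -3733032960, -20404445184, -19552665600, -8334213120, -2123366400, -283115520],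
  [-884736000, -707788800]], [[132710400, 212336640, 84934656]]]

theorem tabCm_eq (a c e : ℝ) :
    2621440000 * (fu (11 / 5 + 3 / 10 * a) (-(5 / 4 * c)) (5 / 4 + e) - f00 (11 / 5 + 3 / 10 * a))
      = Ten.ev a 1 c 1 e 1 tabCm := by
  simp only [tabCm, Ten.ofLists, Ten.ev, Ten.ev1, Ten.ev2, HP.ofList, HP.ev, List.map, List.headD,
    List.tail, Int.cast_zero, mul_zero, zero_add, add_zero,
    one_pow, mul_one]
  unfold fu f00 frakf
  push_cast
  ring

theorem posCm (a c e : ℝ) (ha : 0 ≤ a) (ha1 : a ≤ 1) (hc : 0 ≤ c) (hc1 : c ≤ 1) (he : 0 ≤ e) :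
    f00 (11 / 5 + 3 / 10 * a) ≤ fu (11 / 5 + 3 / 10 * a) (-(5 / 4 * c)) (5 / 4 + e) := by
  have h := Ten.box_inf (.node 2 .leaf .leaf)
    tabCm (by decide +kernel) a c e ha ha1 hc hc1 he
  have h2 := tabCm_eq a c e
  rw [← h2] at h
  linarith

/-! ### Positivity of `f` for `|u| ≤ s / 2` -/

theorem key (s v w : ℝ) (hs : 0 ≤ s) (hs6 : s ^ 2 < 6) (hv : 0 ≤ v) (hvs : v ≤ s / 2)
    (hw : 0 ≤ w) : 0 < fu s v w ∧ 0 < fu s (-v) w := by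
  rcases le_total s (11 / 5) with h | h
  · have hc : 2 * v / s ≤ 1 := div_le_one_of_le₀ (by linarith) hs
    have hc0 : 0 ≤ 2 * v / s := by positivity
    have e1 : 11 / 5 * (5 / 11 * s) = s := by ring
    have e2 : 11 / 10 * (5 / 11 * s) * (2 * v / s) = v := by
      rcases eq_or_lt_of_le hs with h0 | h0
      · have : v = 0 := by linarith
        simp [this]
      · field_simp
        norm_num
    have hp := posP1p (5 / 11 * s) (2 * v / s) w (by positivity) (by linarith) hc0 hc hw
    have hm := posP1m (5 / 11 * s) (2 * v / s) w (by positivity) (by linarith) hc0 hc hw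
    rw [e1, e2] at hp hm
    constructor <;> linarith
  · have hs5 : s ≤ 5 / 2 := by nlinarith
    have hf : 0 < f00 s := by
      unfold f00
      have : 0 < 6 - s ^ 2 := by linarith
      positivity
    have e1 : 11 / 5 + 3 / 10 * (10 / 3 * (s - 11 / 5)) = s := by ring
    have ha : 0 ≤ 10 / 3 * (s - 11 / 5) := by linarith
    have ha1 : 10 / 3 * (s - 11 / 5) ≤ 1 := by linarith
    have e2 : ∀ y : ℝ, 5 / 4 * (4 / 5 * y) = y := fun y => by ring
    rcases le_total (5 / 4) w with h2 | h2
    · have hp := posCp _ (4 / 5 * v) (w - 5 / 4) ha ha1 (by linarith) (by linarith) (by linarith)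
      have hm := posCm _ (4 / 5 * v) (w - 5 / 4) ha ha1 (by linarith) (by linarith) (by linarith)
      rw [e1, e2, add_sub_cancel] at hp hm
      constructor <;> linarith
    · rcases le_total v w with h3 | h3
      · have e3 : 5 / 4 * (v / w) * (4 / 5 * w) = v := by
          rcases eq_or_lt_of_le hw with h0 | h0
          · have : v = 0 := by linarith
            simp [this]
          · field_simp
        have hc : v / w ≤ 1 := div_le_one_of_le₀ h3 hw
        have hc0 : 0 ≤ v / w := by positivity
        have hp := posAp _ (v / w) (4 / 5 * w) ha ha1 hc0 hc (by linarith) (by linarith)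
        have hm := posAm _ (v / w) (4 / 5 * w) ha ha1 hc0 hc (by linarith) (by linarith)
        rw [e1, e2, e3] at hp hm
        constructor <;> linarith
      · have e3 : v * (w / v) = w := by
          rcases eq_or_lt_of_le hv with h0 | h0
          · have : w = 0 := by linarith
            simp [this]
          · field_simp
        have hc : w / v ≤ 1 := div_le_one_of_le₀ h3 hv
        have hc0 : 0 ≤ w / v := by positivity
        have hp := posBp _ (4 / 5 * v) (w / v) ha ha1 (by linarith) (by linarith) hc0 hc
        have hm := posBm _ (4 / 5 * v) (w / v) ha ha1 (by linarith) (by linarith) hc0 hc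
        rw [e1, e2, e3] at hp hm
        constructor <;> linarith

theorem fu_pos (s u w : ℝ) (hs : 0 ≤ s) (hs6 : s ^ 2 < 6) (hu : u ≤ s / 2) (hu' : -u ≤ s / 2) :
    0 < fu s u w := by
  have main : ∀ u w : ℝ, u ≤ s / 2 → -u ≤ s / 2 → 0 ≤ w → 0 < fu s u w := by
    intro u w h1 h2 hw
    rcases le_total 0 u with h | h
    · exact (key s u w hs hs6 h h1 hw).1
    · have := (key s (-u) w hs hs6 (by linarith) h2 hw).2
      rwa [neg_neg] at this
  rcases le_total 0 w with h | h
  · exact main u w hu hu' h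
  · rw [← fu_neg]
    exact main (-u) (-w) hu' (by linarith) (by linarith)

/-! ### The bound `|u| ≤ s / 2` from real-rootedness -/

/-- Newton's inequality for four real numbers. -/
theorem newton_four (a b c d : ℝ) :
    0 ≤ 4 * (a * b + a * c + a * d + b * c + b * d + c * d) ^ 2
      - 9 * (a + b + c + d) * (a * b * c + a * b * d + a * c * d + b * c * d) := by
  nlinarith [sq_nonneg (a * b - c * d), sq_nonneg (a * c - b * d), sq_nonneg (a * d - b * c),
    sq_nonneg (a * (b - c)), sq_nonneg (a * (b - d)), sq_nonneg (a * (c - d)),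
    sq_nonneg (b * (a - c)), sq_nonneg (b * (a - d)), sq_nonneg (b * (c - d)),
    sq_nonneg (c * (a - b)), sq_nonneg (c * (a - d)), sq_nonneg (c * (b - d)),
    sq_nonneg (d * (a - b)), sq_nonneg (d * (a - c)), sq_nonneg (d * (b - c))]

theorem sigma_ineq (s u a b c d t : ℝ) (h1 : a + b + c + d = u)
    (h2 : a * b + a * c + a * d + b * c + b * d + c * d = -s)
    (h3 : a * b * c + a * b * d + a * c * d + b * c * d = u) :
    0 ≤ (9 * u ^ 2 + 24 * s) * t ^ 2 - 6 * u * (s + 6) * t + (4 * s ^ 2 - 9 * u ^ 2) := by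
  have h := newton_four (a + t) (b + t) (c + t) (d + t)
  have e1 : (a + t) + (b + t) + (c + t) + (d + t) = u + 4 * t := by linear_combination h1
  have e2 : (a + t) * (b + t) + (a + t) * (c + t) + (a + t) * (d + t) + (b + t) * (c + t)
      + (b + t) * (d + t) + (c + t) * (d + t) = -s + 3 * u * t + 6 * t ^ 2 := by
    linear_combination h2 + 3 * t * h1
  have e3 : (a + t) * (b + t) * (c + t) + (a + t) * (b + t) * (d + t)
      + (a + t) * (c + t) * (d + t) + (b + t) * (c + t) * (d + t)
      = u - 2 * s * t + 3 * u * t ^ 2 + 4 * t ^ 3 := by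
    linear_combination h3 + 2 * t * h2 + 3 * t ^ 2 * h1
  rw [e1, e2, e3] at h
  nlinarith [h]

theorem u_le (s u : ℝ) (hs : 0 ≤ s) (hs6 : s ^ 2 < 6)
    (h : ∀ t : ℝ, 0 ≤ (9 * u ^ 2 + 24 * s) * t ^ 2 - 6 * u * (s + 6) * t
      + (4 * s ^ 2 - 9 * u ^ 2)) : u ≤ s / 2 := by
  by_contra hu
  push Not at hu
  have hs5 : s < 5 / 2 := by nlinarith
  have h1 := h (s / 6)
  obtain ⟨y, rfl⟩ : ∃ y, u = s / 2 + y := ⟨u - s / 2, by ring⟩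
  have hy : 0 < y := by linarith
  have hss : 0 ≤ s * s := by positivity
  have h3 : 0 ≤ s * s * s := by positivity
  have hys : 0 ≤ y * s := by positivity
  have hyss : 0 ≤ y * s * s := by positivity
  have q1 : s * s * s * s ≤ 5 / 2 * (s * s * s) := by nlinarith
  have q2 : s * s * s ≤ 5 / 2 * (s * s) := by nlinarith
  have q3 : y * s * s * s ≤ 6 * (y * s) := by nlinarith
  have q4 : y * y * s * s ≤ 6 * (y * y) := by nlinarith [mul_pos hy hy]
  nlinarith [mul_pos hy hy]

theorem exists_root (s1 s2 s3 : ℝ) : ∃ p : ℝ, p ^ 3 - s1 * p ^ 2 + s2 * p - s3 = 0 := by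
  have hc : Continuous fun p : ℝ => p ^ 3 - s1 * p ^ 2 + s2 * p - s3 := by fun_prop
  set N := 1 + |s1| + |s2| + |s3| with hN
  have a1 := abs_nonneg s1
  have a2 := abs_nonneg s2
  have a3 := abs_nonneg s3
  have hN1 : 1 ≤ N := by linarith
  have hNN : N ≤ N ^ 2 := by nlinarith
  have hN2 : 1 ≤ N ^ 2 := by linarith
  have hN3 : N ^ 3 = N ^ 2 + |s1| * N ^ 2 + |s2| * N ^ 2 + |s3| * N ^ 2 := by
    rw [pow_succ N 2]
    nth_rewrite 2 [hN]
    ring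
  have b1 : |s1 * N ^ 2| = |s1| * N ^ 2 := by rw [abs_mul, abs_of_nonneg (by positivity : 0 ≤ N ^ 2)]
  have b2 : |s2 * N| ≤ |s2| * N ^ 2 := by
    rw [abs_mul, abs_of_nonneg (by linarith : 0 ≤ N)]
    exact mul_le_mul_of_nonneg_left hNN a2
  have b3 : |s3| ≤ |s3| * N ^ 2 := le_mul_of_one_le_right a3 hN2
  have c1 := abs_le.mp b1.le
  have c2 := abs_le.mp b2
  have c3 := abs_le.mp b3
  obtain ⟨p, hp⟩ := mem_range_of_exists_le_of_exists_ge hc (c := 0)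
    ⟨-N, by
      have : (-N) ^ 3 - s1 * (-N) ^ 2 + s2 * (-N) - s3 = -N ^ 3 - s1 * N ^ 2 - s2 * N - s3 := by
        ring
      simp only [this]
      linarith [c1.1, c2.1, c3.1]⟩
    ⟨N, by
      show 0 ≤ N ^ 3 - s1 * N ^ 2 + s2 * N - s3
      linarith [c1.2, c2.1, c3.2]⟩
  exact ⟨p, hp⟩

theorem real_roots (s1 s2 s3 : ℝ) (h : 0 ≤ s1 ^ 2 * s2 ^ 2 - 4 * s2 ^ 3 - 4 * s1 ^ 3 * s3
      + 18 * s1 * s2 * s3 - 27 * s3 ^ 2) :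
    ∃ p q r : ℝ, p + q + r = s1 ∧ p * q + p * r + q * r = s2 ∧ p * q * r = s3 := by
  obtain ⟨p, hp⟩ := exists_root s1 s2 s3
  have h3 : s3 = p ^ 3 - s1 * p ^ 2 + s2 * p := by linarith
  have hD : 0 ≤ (s1 - p) ^ 2 - 4 * (s2 + p ^ 2 - p * s1) := by
    by_contra hD
    push Not at hD
    have e : s1 ^ 2 * s2 ^ 2 - 4 * s2 ^ 3 - 4 * s1 ^ 3 * s3 + 18 * s1 * s2 * s3 - 27 * s3 ^ 2
        = ((s1 - p) ^ 2 - 4 * (s2 + p ^ 2 - p * s1)) * (3 * p ^ 2 - 2 * s1 * p + s2) ^ 2 := by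
      rw [h3]; ring
    rw [e] at h
    have hq : (3 * p ^ 2 - 2 * s1 * p + s2) ^ 2 = 0 := by
      by_contra hne
      have : 0 < (3 * p ^ 2 - 2 * s1 * p + s2) ^ 2 := lt_of_le_of_ne (sq_nonneg _) (Ne.symm hne)
      nlinarith
    have hq' : 3 * p ^ 2 - 2 * s1 * p + s2 = 0 := by simpa using hq
    nlinarith [sq_nonneg (3 * p - s1)]
  have hr := Real.sq_sqrt hD
  set z := Real.sqrt ((s1 - p) ^ 2 - 4 * (s2 + p ^ 2 - p * s1)) with hz
  refine ⟨p, (s1 - p + z) / 2, (s1 - p - z) / 2, by ring, ?_, ?_⟩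
  · linear_combination (-1 / 4) * hr
  · rw [h3]
    linear_combination (-p / 4) * hr

theorem claim_cayley (ς : ℝ) (h0 : 0 ≤ ς) (h6 : ς < Real.sqrt 6)
    (s1 w : ℝ) (hg : 0 ≤ frakg s1 (-ς - w * s1) w) :
    0 < frakf s1 (-ς - w * s1) w := by
  have h62 : ς ^ 2 < 6 := by
    have h1 := Real.sq_sqrt (show (0 : ℝ) ≤ 6 by norm_num)
    have h2 := Real.sqrt_nonneg 6
    nlinarith
  have hfu : frakf s1 (-ς - w * s1) w = fu ς (s1 + w) w := by
    unfold fu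
    rw [add_sub_cancel_right]
  rw [hfu]
  obtain ⟨p, q, r, e1, e2, e3⟩ := real_roots s1 (-ς - w * s1)
    (s1 + w - w * (-ς - w * s1)) (by
      refine le_of_le_of_eq hg ?_
      unfold frakg
      ring)
  have hs : ∀ t : ℝ, 0 ≤ (9 * (s1 + w) ^ 2 + 24 * ς) * t ^ 2 - 6 * (s1 + w) * (ς + 6) * t
      + (4 * ς ^ 2 - 9 * (s1 + w) ^ 2) := fun t =>
    sigma_ineq ς (s1 + w) w p q r t (by linear_combination e1)
      (by linear_combination e2 + w * e1) (by linear_combination e3 + w * e2)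
  refine fu_pos ς (s1 + w) w h0 h62 (u_le ς _ h0 h62 hs) (u_le ς _ h0 h62 fun t => ?_)
  have := hs (-t)
  nlinarith [this]
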